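/- Let Ω be a bounded Lipschitz domain in ℝ^N (N ≥ 2), s ∈ (0,1), p a continuous symmetric function on ℝ^N×ℝ^N with 1 < inf p ≤ sup p < N/s, and let f satisfy (F1) with exponent q, q⁺ := sup_{Ω̄} q. Let u ∈ W₀^{s,p(·,·)}(Ω) be a weak solution of (−Δ)^s_{p(x)} u = f(x,u) in Ω, u = 0 on ℝ^N∖Ω. For k* > 0 set k_n := k*(2 − 2^{−n}), A_k := {x ∈ Ω : u(x) > k}, Z_n := ∫_{A_{k_n}} (u − k_n)^{q(x)} dx, and u_n := (u − k_{n+1})₊. Then there exists a constant C₁ > 0 independent of u and n such that for all n ∈ ℕ₀, ∫_{ℝ^N}∫_{ℝ^N} |u_n(x) − u_n(y)|^{p(x,y)} / |x−y|^{N+s p(x,y)} dx dy ≤ C₁ (1 + k*^{−q⁺}) 2^{n q⁺} Z_n. -/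

import Mathlib

open MeasureTheory Metric Set Filter
open scoped ENNReal NNReal

noncomputable section

/-- `Ω` is a (bounded or unbounded) Lipschitz domain in `ℝ^N`: it is open, nonempty, and near
every boundary point, after a rigid motion (an isometry of `ℝ^N`), `Ω` coincides with the strict
epigraph of a Lipschitz function of the first `N-1` coordinates. -/
def IsLipschitzDomain {N : ℕ} (Ω : Set (EuclideanSpace ℝ (Fin N))) : Prop :=
  IsOpen Ω ∧ Ω.Nonempty ∧
    ∀ z ∈ frontier Ω, ∃ r : ℝ, 0 < r ∧
      ∃ e : EuclideanSpace ℝ (Fin N) ≃ᵢ EuclideanSpace ℝ (Fin N),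
        ∃ L : NNReal, ∃ φ : EuclideanSpace ℝ (Fin N) → ℝ, LipschitzWith L φ ∧
          (∀ x y : EuclideanSpace ℝ (Fin N),
            (∀ i : Fin N, (i : ℕ) + 1 < N → x i = y i) → φ x = φ y) ∧
          ∀ hN : 0 < N, ∀ x ∈ Metric.ball z r,
            (x ∈ Ω ↔ φ (e x) < (e x) ⟨N - 1, Nat.sub_lt hN Nat.one_pos⟩)

/-- The modular `∫_Ω |u(x)|^{q(x)} dx` of the variable exponent Lebesgue space `L^{q(·)}(Ω)`. -/
def modLq {N : ℕ} (Ω : Set (EuclideanSpace ℝ (Fin N))) (q : EuclideanSpace ℝ (Fin N) → ℝ)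
    (u : EuclideanSpace ℝ (Fin N) → ℝ) : ℝ≥0∞ :=
  ∫⁻ x in Ω, ENNReal.ofReal (|u x| ^ q x)

/-- The Luxemburg norm `‖u‖_{L^{q(·)}(Ω)} = inf {λ > 0 : ∫_Ω |u(x)/λ|^{q(x)} dx ≤ 1}`. -/
def luxNorm {N : ℕ} (Ω : Set (EuclideanSpace ℝ (Fin N))) (q : EuclideanSpace ℝ (Fin N) → ℝ)
    (u : EuclideanSpace ℝ (Fin N) → ℝ) : ℝ :=
  sInf {l : ℝ | 0 < l ∧ modLq Ω q (fun x => u x / l) ≤ 1}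

/-- The Gagliardo modular
`∫_Ω ∫_Ω |u(x)-u(y)|^{p(x,y)} / |x-y|^{N+s·p(x,y)} dx dy` with variable exponent `p`. -/
def gagMod {N : ℕ} (Ω : Set (EuclideanSpace ℝ (Fin N))) (s : ℝ)
    (p : EuclideanSpace ℝ (Fin N) → EuclideanSpace ℝ (Fin N) → ℝ)
    (u : EuclideanSpace ℝ (Fin N) → ℝ) : ℝ≥0∞ :=
  ∫⁻ x in Ω, ∫⁻ y in Ω,
    ENNReal.ofReal (|u x - u y| ^ p x y / ‖x - y‖ ^ ((N : ℝ) + s * p x y))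

/-- The Gagliardo seminorm
`[u]_{s,p(·,·),Ω} = inf {λ > 0 : ∫_Ω ∫_Ω |u(x)-u(y)|^{p(x,y)}/(λ^{p(x,y)}|x-y|^{N+s p(x,y)}) < 1}`. -/
def gagSeminorm {N : ℕ} (Ω : Set (EuclideanSpace ℝ (Fin N))) (s : ℝ)
    (p : EuclideanSpace ℝ (Fin N) → EuclideanSpace ℝ (Fin N) → ℝ)
    (u : EuclideanSpace ℝ (Fin N) → ℝ) : ℝ :=
  sInf {l : ℝ | 0 < l ∧ gagMod Ω s p (fun x => u x / l) < 1}

/-- The norm `‖u‖_{s,q,p,Ω} = ‖u‖_{L^{q(·)}(Ω)} + [u]_{s,p(·,·),Ω}` of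
`W^{s,q(·),p(·,·)}(Ω)`. -/
def sobNorm {N : ℕ} (Ω : Set (EuclideanSpace ℝ (Fin N))) (q : EuclideanSpace ℝ (Fin N) → ℝ)
    (s : ℝ) (p : EuclideanSpace ℝ (Fin N) → EuclideanSpace ℝ (Fin N) → ℝ)
    (u : EuclideanSpace ℝ (Fin N) → ℝ) : ℝ :=
  luxNorm Ω q u + gagSeminorm Ω s p u

/-- Membership in `W^{s,q(·),p(·,·)}(Ω)`: `u` is measurable, lies in `L^{q(·)}(Ω)`, and its
Gagliardo modular is finite. -/
def memW {N : ℕ} (Ω : Set (EuclideanSpace ℝ (Fin N))) (q : EuclideanSpace ℝ (Fin N) → ℝ)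
    (s : ℝ) (p : EuclideanSpace ℝ (Fin N) → EuclideanSpace ℝ (Fin N) → ℝ)
    (u : EuclideanSpace ℝ (Fin N) → ℝ) : Prop :=
  Measurable u ∧ modLq Ω q u < ⊤ ∧ gagMod Ω s p u < ⊤

/-- The log-Hölder type condition (LH) on the exponent `p` on `ℝ^N × ℝ^N`:
`inf_{ε>0} sup { |p(x,y) − inf_{B_ε((x,y))} p| · log(1/|x−y|) : 0 < |x−y| < 1/2 } < ∞`,
i.e. for some radius `ε > 0` the displayed supremum is bounded by some constant `C`. -/
def LHCondition {N : ℕ} (p : EuclideanSpace ℝ (Fin N) → EuclideanSpace ℝ (Fin N) → ℝ) : Prop :=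
  ∃ C : ℝ, ∃ ε : ℝ, 0 < ε ∧ ∀ x y : EuclideanSpace ℝ (Fin N),
    0 < ‖x - y‖ → ‖x - y‖ < 1 / 2 →
      |p x y - sInf ((fun z : EuclideanSpace ℝ (Fin N) × EuclideanSpace ℝ (Fin N) => p z.1 z.2) ''
          Metric.ball ((x, y) : EuclideanSpace ℝ (Fin N) × EuclideanSpace ℝ (Fin N)) ε)| *
        Real.log (1 / ‖x - y‖) ≤ C

/-- Membership in `W₀^{s,p(·,·)}(Ω)`: `u ∈ W^{s,p(·,·)}(ℝ^N)` (measurable, `L^{p(·)}(ℝ^N)`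
modular and full-space Gagliardo modular finite) and `u = 0` on `ℝ^N ∖ Ω`. -/
def memW0 {N : ℕ} (Ω : Set (EuclideanSpace ℝ (Fin N))) (s : ℝ)
    (p : EuclideanSpace ℝ (Fin N) → EuclideanSpace ℝ (Fin N) → ℝ)
    (u : EuclideanSpace ℝ (Fin N) → ℝ) : Prop :=
  Measurable u ∧ modLq Set.univ (fun x => p x x) u < ⊤ ∧ gagMod Set.univ s p u < ⊤ ∧
    ∀ x, x ∉ Ω → u x = 0

/-- `u` is a weak solution of `(−Δ)^s_{p(x)} u = f(x,u)` in `Ω`, `u = 0` on `ℝ^N ∖ Ω`: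
`u ∈ W₀^{s,p(·,·)}(Ω)` and the weak formulation holds against every `v ∈ W₀^{s,p(·,·)}(Ω)`. -/
def IsWeakSolution {N : ℕ} (Ω : Set (EuclideanSpace ℝ (Fin N))) (s : ℝ)
    (p : EuclideanSpace ℝ (Fin N) → EuclideanSpace ℝ (Fin N) → ℝ)
    (f : EuclideanSpace ℝ (Fin N) → ℝ → ℝ)
    (u : EuclideanSpace ℝ (Fin N) → ℝ) : Prop :=
  memW0 Ω s p u ∧ ∀ v : EuclideanSpace ℝ (Fin N) → ℝ, memW0 Ω s p v →
    (∫ x : EuclideanSpace ℝ (Fin N), ∫ y : EuclideanSpace ℝ (Fin N),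
        |u x - u y| ^ (p x y - 2) * (u x - u y) * (v x - v y) /
          ‖x - y‖ ^ ((N : ℝ) + s * p x y))
      = ∫ x in Ω, f x (u x) * v x

theorem measurable_gagliardo_quotient {N : ℕ} {s : ℝ}
    {p : EuclideanSpace ℝ (Fin N) → EuclideanSpace ℝ (Fin N) → ℝ}
    (hp : Measurable fun z : EuclideanSpace ℝ (Fin N) × EuclideanSpace ℝ (Fin N) => p z.1 z.2)
    {u : EuclideanSpace ℝ (Fin N) → ℝ} (hu : Measurable u) :
    Measurable fun z : EuclideanSpace ℝ (Fin N) × EuclideanSpace ℝ (Fin N) =>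
      |u z.1 - u z.2| ^ p z.1 z.2 / ‖z.1 - z.2‖ ^ ((N : ℝ) + s * p z.1 z.2) := by
  have h1 : Measurable fun z : EuclideanSpace ℝ (Fin N) × EuclideanSpace ℝ (Fin N) =>
      u z.1 - u z.2 := (hu.comp measurable_fst).sub (hu.comp measurable_snd)
  have h2 : Measurable fun z : EuclideanSpace ℝ (Fin N) × EuclideanSpace ℝ (Fin N) =>
      |u z.1 - u z.2| := by simpa only [Real.norm_eq_abs] using h1.norm
  have h3 : Measurable fun z : EuclideanSpace ℝ (Fin N) × EuclideanSpace ℝ (Fin N) =>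
      ‖z.1 - z.2‖ := (measurable_fst.sub measurable_snd).norm
  exact (h2.pow hp).div (h3.pow ((hp.const_mul s).const_add (N : ℝ)))

theorem measurable_gagliardo_form {N : ℕ} {s : ℝ}
    {p : EuclideanSpace ℝ (Fin N) → EuclideanSpace ℝ (Fin N) → ℝ}
    (hp : Measurable fun z : EuclideanSpace ℝ (Fin N) × EuclideanSpace ℝ (Fin N) => p z.1 z.2)
    {u v : EuclideanSpace ℝ (Fin N) → ℝ} (hu : Measurable u) (hv : Measurable v) :
    Measurable fun z : EuclideanSpace ℝ (Fin N) × EuclideanSpace ℝ (Fin N) =>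
      |u z.1 - u z.2| ^ (p z.1 z.2 - 2) * (u z.1 - u z.2) * (v z.1 - v z.2) /
        ‖z.1 - z.2‖ ^ ((N : ℝ) + s * p z.1 z.2) := by
  have h1 : Measurable fun z : EuclideanSpace ℝ (Fin N) × EuclideanSpace ℝ (Fin N) =>
      u z.1 - u z.2 := (hu.comp measurable_fst).sub (hu.comp measurable_snd)
  have h1' : Measurable fun z : EuclideanSpace ℝ (Fin N) × EuclideanSpace ℝ (Fin N) =>
      v z.1 - v z.2 := (hv.comp measurable_fst).sub (hv.comp measurable_snd)
  have h2 : Measurable fun z : EuclideanSpace ℝ (Fin N) × EuclideanSpace ℝ (Fin N) =>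
      |u z.1 - u z.2| := by simpa only [Real.norm_eq_abs] using h1.norm
  have h3 : Measurable fun z : EuclideanSpace ℝ (Fin N) × EuclideanSpace ℝ (Fin N) =>
      ‖z.1 - z.2‖ := (measurable_fst.sub measurable_snd).norm
  exact ((((h2.pow (hp.sub_const 2)).mul h1).mul h1')).div
    (h3.pow ((hp.const_mul s).const_add (N : ℝ)))

theorem gagMod_univ_eq_lintegral_prod {N : ℕ} {s : ℝ}
    {p : EuclideanSpace ℝ (Fin N) → EuclideanSpace ℝ (Fin N) → ℝ}
    (hp : Measurable fun z : EuclideanSpace ℝ (Fin N) × EuclideanSpace ℝ (Fin N) => p z.1 z.2)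
    {u : EuclideanSpace ℝ (Fin N) → ℝ} (hu : Measurable u) :
    gagMod Set.univ s p u =
      ∫⁻ z : EuclideanSpace ℝ (Fin N) × EuclideanSpace ℝ (Fin N),
        ENNReal.ofReal
          (|u z.1 - u z.2| ^ p z.1 z.2 / ‖z.1 - z.2‖ ^ ((N : ℝ) + s * p z.1 z.2)) := by
  rw [Measure.volume_eq_prod,
    lintegral_prod _ (measurable_gagliardo_quotient hp hu).ennreal_ofReal.aemeasurable]
  simp only [gagMod, Measure.restrict_univ]

theorem abs_rpow_sub_two_mul_self_mul {a : ℝ} (ha : a ≠ 0) (b p : ℝ) (hab : 0 ≤ a * b) :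
    |a| ^ (p - 2) * a * b = |a| ^ (p - 1) * |b| := by
  have h : |a| ^ (p - 1) = |a| ^ (p - 2) * |a| := by
    rw [← Real.rpow_add_one (abs_ne_zero.2 ha)]
    ring_nf
  rw [h, mul_assoc, mul_assoc, ← abs_mul, abs_of_nonneg hab]

theorem abs_rpow_le_rpow_sub_two_mul {a b p : ℝ} (hp : 1 < p) (hab : 0 ≤ a * b)
    (hle : |b| ≤ |a|) : |b| ^ p ≤ |a| ^ (p - 2) * a * b := by
  rcases eq_or_ne b 0 with rfl | hb
  · simp [Real.zero_rpow (by linarith : p ≠ 0)]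
  have ha : a ≠ 0 := by
    rintro rfl
    exact hb (by simpa using hle)
  rw [abs_rpow_sub_two_mul_self_mul ha b p hab]
  have h : |b| ^ p = |b| ^ (p - 1) * |b| := by
    rw [← Real.rpow_add_one (abs_ne_zero.2 hb)]
    ring_nf
  rw [h]
  have : |b| ^ (p - 1) ≤ |a| ^ (p - 1) :=
    Real.rpow_le_rpow (abs_nonneg _) hle (by linarith)
  gcongr

theorem rpow_sub_two_mul_le_abs_rpow {a b p : ℝ} (hp : 1 < p) (hab : 0 ≤ a * b)
    (hle : |b| ≤ |a|) : |a| ^ (p - 2) * a * b ≤ |a| ^ p := by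
  rcases eq_or_ne a 0 with rfl | ha
  · simp [Real.zero_rpow (by linarith : p ≠ 0)]
  rw [abs_rpow_sub_two_mul_self_mul ha b p hab]
  have h : |a| ^ p = |a| ^ (p - 1) * |a| := by
    rw [← Real.rpow_add_one (abs_ne_zero.2 ha)]
    ring_nf
  rw [h]
  gcongr

theorem sub_mul_posPart_sub_nonneg (a b k : ℝ) :
    0 ≤ (a - b) * (max (a - k) 0 - max (b - k) 0) := by
  rcases le_total a b with h | h
  · exact mul_nonneg_of_nonpos_of_nonpos (by linarith)
      (sub_nonpos.2 (max_le_max_right 0 (by linarith)))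
  · exact mul_nonneg (by linarith) (sub_nonneg.2 (max_le_max_right 0 (by linarith)))

theorem abs_posPart_sub_le (a b k : ℝ) :
    |max (a - k) 0 - max (b - k) 0| ≤ |a - b| := by
  simpa using abs_max_sub_max_le_abs (a - k) (b - k) 0

theorem abs_posPart_le {a k : ℝ} (hk : 0 ≤ k) : |max (a - k) 0| ≤ |a| := by
  rw [abs_of_nonneg (le_max_right _ _)]
  exact max_le (by linarith [le_abs_self a]) (abs_nonneg a)

theorem memW0_posPart {N : ℕ} {Ω : Set (EuclideanSpace ℝ (Fin N))} {s : ℝ}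
    {p : EuclideanSpace ℝ (Fin N) → EuclideanSpace ℝ (Fin N) → ℝ}
    (hp : ∀ x y, 0 ≤ p x y) {u : EuclideanSpace ℝ (Fin N) → ℝ} (hu : memW0 Ω s p u)
    {k : ℝ} (hk : 0 ≤ k) : memW0 Ω s p fun x => max (u x - k) 0 := by
  obtain ⟨hm, hL, hG, h0⟩ := hu
  refine ⟨(hm.sub_const k).max measurable_const, lt_of_le_of_lt ?_ hL,
    lt_of_le_of_lt ?_ hG, fun x hx => ?_⟩
  · exact lintegral_mono fun x => ENNReal.ofReal_le_ofReal
      (Real.rpow_le_rpow (abs_nonneg _) (abs_posPart_le hk) (hp x x))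
  · refine lintegral_mono fun x => lintegral_mono fun y => ENNReal.ofReal_le_ofReal ?_
    exact div_le_div_of_nonneg_right
      (Real.rpow_le_rpow (abs_nonneg _) (abs_posPart_sub_le _ _ _) (hp x y)) (by positivity)
  · simp [h0 x hx, hk]

/-- Caccioppoli-type inequality: the Gagliardo energy of a truncation `(u - k)₊` is controlled by
testing the operator at `u` against that truncation. -/
theorem gagMod_posPart_le {N : ℕ} {s : ℝ}
    {p : EuclideanSpace ℝ (Fin N) → EuclideanSpace ℝ (Fin N) → ℝ}
    (hpm : Measurable fun z : EuclideanSpace ℝ (Fin N) × EuclideanSpace ℝ (Fin N) => p z.1 z.2)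
    (hp : ∀ x y, 1 < p x y) {u : EuclideanSpace ℝ (Fin N) → ℝ} (hu : Measurable u)
    (hG : gagMod Set.univ s p u < ⊤) (k : ℝ) :
    gagMod Set.univ s p (fun x => max (u x - k) 0) ≤
      ENNReal.ofReal (∫ x : EuclideanSpace ℝ (Fin N), ∫ y : EuclideanSpace ℝ (Fin N),
        |u x - u y| ^ (p x y - 2) * (u x - u y) * (max (u x - k) 0 - max (u y - k) 0) /
          ‖x - y‖ ^ ((N : ℝ) + s * p x y)) := by
  have hv : Measurable fun x => max (u x - k) 0 := (hu.sub_const k).max measurable_const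
  have hF := measurable_gagliardo_form (s := s) hpm hu hv
  have hnn : ∀ z : EuclideanSpace ℝ (Fin N) × EuclideanSpace ℝ (Fin N),
      0 ≤ |u z.1 - u z.2| ^ (p z.1 z.2 - 2) * (u z.1 - u z.2) *
        (max (u z.1 - k) 0 - max (u z.2 - k) 0) /
          ‖z.1 - z.2‖ ^ ((N : ℝ) + s * p z.1 z.2) := fun z => by
    rw [mul_assoc]
    exact div_nonneg (mul_nonneg (by positivity) (sub_mul_posPart_sub_nonneg _ _ _))
      (by positivity)
  have hGu : Integrable (fun z : EuclideanSpace ℝ (Fin N) × EuclideanSpace ℝ (Fin N) =>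
      |u z.1 - u z.2| ^ p z.1 z.2 / ‖z.1 - z.2‖ ^ ((N : ℝ) + s * p z.1 z.2)) := by
    refine (lintegral_ofReal_ne_top_iff_integrable
      (measurable_gagliardo_quotient hpm hu).aestronglyMeasurable
      (Eventually.of_forall fun z => by positivity)).1 ?_
    rw [← gagMod_univ_eq_lintegral_prod hpm hu]
    exact hG.ne
  have hInt : Integrable (fun z : EuclideanSpace ℝ (Fin N) × EuclideanSpace ℝ (Fin N) =>
      |u z.1 - u z.2| ^ (p z.1 z.2 - 2) * (u z.1 - u z.2) *
        (max (u z.1 - k) 0 - max (u z.2 - k) 0) /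
          ‖z.1 - z.2‖ ^ ((N : ℝ) + s * p z.1 z.2)) := by
    refine hGu.mono' hF.aestronglyMeasurable (Eventually.of_forall fun z => ?_)
    rw [Real.norm_of_nonneg (hnn z)]
    exact div_le_div_of_nonneg_right (rpow_sub_two_mul_le_abs_rpow (hp _ _)
      (sub_mul_posPart_sub_nonneg _ _ _) (abs_posPart_sub_le _ _ _)) (by positivity)
  have hFub := integral_prod _ hInt
  rw [← hFub, ← Measure.volume_eq_prod,
    ofReal_integral_eq_lintegral_ofReal hInt (Eventually.of_forall hnn),
    gagMod_univ_eq_lintegral_prod hpm hv]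
  refine lintegral_mono fun z => ENNReal.ofReal_le_ofReal ?_
  exact div_le_div_of_nonneg_right (abs_rpow_le_rpow_sub_two_mul (hp _ _)
    (sub_mul_posPart_sub_nonneg _ _ _) (abs_posPart_sub_le _ _ _)) (by positivity)

theorem ofReal_integral_le_lintegral_ofReal {α : Type*} [MeasurableSpace α] (μ : Measure α)
    (g : α → ℝ) : ENNReal.ofReal (∫ x, g x ∂μ) ≤ ∫⁻ x, ENNReal.ofReal (g x) ∂μ := by
  by_cases hg : Integrable g μ
  · rw [integral_eq_lintegral_pos_part_sub_lintegral_neg_part hg]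
    exact (ENNReal.ofReal_le_ofReal (sub_le_self _ ENNReal.toReal_nonneg)).trans
      ENNReal.ofReal_toReal_le
  · simp [integral_undef hg]

/-- The growth function `(1 + t ^ (q - 1)) (t - k')` above the level `k'` is controlled by
`(t - k) ^ q` when `k < k' < t` are consecutive levels `K (2 - 2⁻ⁿ)`. -/
theorem one_add_rpow_mul_le_level {K t q Q m : ℝ} (hK : 0 < K) (hq : 1 ≤ q) (hqQ : q ≤ Q)
    (hm : 0 ≤ m) (ht : K * (2 - 2 ^ (-(m + 1))) < t) :
    (1 + t ^ (q - 1)) * (t - K * (2 - 2 ^ (-(m + 1)))) ≤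
      2 * 2 ^ (2 * Q) * (1 + K ^ (-Q)) * 2 ^ (m * Q) * (t - K * (2 - 2 ^ (-m))) ^ q := by
  have h2 : (2 : ℝ) ^ (-m) = 2 * 2 ^ (-(m + 1)) := by
    rw [show -m = 1 + -(m + 1) by ring, Real.rpow_add two_pos, Real.rpow_one]
  set d : ℝ := 2 ^ (-(m + 1)) with hd
  have hd0 : 0 < d := by positivity
  have hd1 : d ≤ 1 := Real.rpow_le_one_of_one_le_of_nonpos (by norm_num) (by linarith)
  rw [h2]
  set w := t - K * (2 - 2 * d) with hw
  have hwd : K * d ≤ w := by rw [hw]; nlinarith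
  have hw0 : 0 < w := lt_of_lt_of_le (by positivity) hwd
  have ht0 : 0 < t := lt_of_le_of_lt (by nlinarith) ht
  have hdi : d⁻¹ = 2 ^ (m + 1) := by rw [hd, Real.rpow_neg (by norm_num), inv_inv]
  have hwq : w ^ q = w ^ (q - 1) * w := by
    rw [← Real.rpow_add_one hw0.ne']
    ring_nf
  have hpow : (2 : ℝ) ^ ((m + 2) * (q - 1)) ≤ 2 ^ (2 * Q) * 2 ^ (m * Q) := by
    rw [← Real.rpow_add (by norm_num)]
    exact Real.rpow_le_rpow_of_exponent_le (by norm_num) (by nlinarith)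
  have hKQ : K ^ (-(q - 1)) ≤ 1 + K ^ (-Q) := by
    have hpos : 0 < K ^ (-Q) := by positivity
    rcases le_total 1 K with h | h
    · have := Real.rpow_le_one_of_one_le_of_nonpos h (by linarith : -(q - 1) ≤ 0)
      linarith
    · have := Real.rpow_le_rpow_of_exponent_ge hK h (by linarith : -Q ≤ -(q - 1))
      linarith
  have h4 : (2 : ℝ) ^ (m + 2) = 2 * d⁻¹ := by
    rw [hdi, show m + 2 = 1 + (m + 1) by ring, Real.rpow_add two_pos, Real.rpow_one]
  have htw : t ≤ 2 ^ (m + 2) * w := by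
    rw [h4]
    have : t * d ≤ 2 * w := by
      rw [hw]
      nlinarith [mul_nonneg (sub_nonneg.2 hd1) ht0.le]
    calc t = t * d * d⁻¹ := by field_simp
      _ ≤ 2 * w * d⁻¹ := by gcongr
      _ = 2 * d⁻¹ * w := by ring
  have hA : t ^ (q - 1) ≤ 2 ^ (2 * Q) * 2 ^ (m * Q) * w ^ (q - 1) := by
    calc t ^ (q - 1) ≤ (2 ^ (m + 2) * w) ^ (q - 1) :=
          Real.rpow_le_rpow ht0.le htw (by linarith)
      _ = 2 ^ ((m + 2) * (q - 1)) * w ^ (q - 1) := by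
          rw [Real.mul_rpow (by positivity) hw0.le, ← Real.rpow_mul (by norm_num)]
      _ ≤ _ := by gcongr
  have hKw : K ≤ 2 ^ (m + 2) * w := by
    rw [h4]
    calc K = K * d * d⁻¹ := by field_simp
      _ ≤ w * d⁻¹ := by gcongr
      _ ≤ 2 * d⁻¹ * w := by nlinarith [mul_pos hw0 (inv_pos.2 hd0)]
  have hB : 1 ≤ 2 ^ (2 * Q) * 2 ^ (m * Q) * (1 + K ^ (-Q)) * w ^ (q - 1) := by
    have h1 : K ^ (q - 1) ≤ 2 ^ (2 * Q) * 2 ^ (m * Q) * w ^ (q - 1) := by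
      calc K ^ (q - 1) ≤ (2 ^ (m + 2) * w) ^ (q - 1) :=
            Real.rpow_le_rpow hK.le hKw (by linarith)
        _ = 2 ^ ((m + 2) * (q - 1)) * w ^ (q - 1) := by
            rw [Real.mul_rpow (by positivity) hw0.le, ← Real.rpow_mul (by norm_num)]
        _ ≤ _ := by gcongr
    calc (1 : ℝ) = K ^ (q - 1) * K ^ (-(q - 1)) := by
          rw [← Real.rpow_add hK]; simp
      _ ≤ 2 ^ (2 * Q) * 2 ^ (m * Q) * w ^ (q - 1) * (1 + K ^ (-Q)) := by gcongr
      _ = _ := by ring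
  have hA' : t ^ (q - 1) ≤ 2 ^ (2 * Q) * 2 ^ (m * Q) * (1 + K ^ (-Q)) * w ^ (q - 1) := by
    refine hA.trans (mul_le_mul_of_nonneg_right ?_ (by positivity))
    exact le_mul_of_one_le_right (by positivity) (by linarith [Real.rpow_nonneg hK.le (-Q)])
  calc (1 + t ^ (q - 1)) * (t - K * (2 - d)) ≤ (1 + t ^ (q - 1)) * w := by
        gcongr
        rw [hw]; nlinarith
    _ ≤ (2 ^ (2 * Q) * 2 ^ (m * Q) * (1 + K ^ (-Q)) * w ^ (q - 1) +
          2 ^ (2 * Q) * 2 ^ (m * Q) * (1 + K ^ (-Q)) * w ^ (q - 1)) * w := by gcongr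
    _ = _ := by rw [hwq]; ring

/-- **Estimate (4.7) (Step 1 of the proof of Theorem 4.2):** for a weak solution `u` of
`(−Δ)^s_{p(x)} u = f(x,u)`, with `k_n = k*(2 − 2^{−n})`, `u_n = (u − k_{n+1})₊`,
`Z_n = ∫_{A_{k_n}} (u − k_n)^{q(x)} dx`, there is `C₁ > 0` independent of `u` and `n` with
`∫_{ℝ^N}∫_{ℝ^N} |u_n(x)−u_n(y)|^{p(x,y)}/|x−y|^{N+s p(x,y)} ≤ C₁ (1 + k*^{−q⁺}) 2^{n q⁺} Z_n`. -/
theorem stmt_14 {N : ℕ} (hN : 2 ≤ N) (Ω : Set (EuclideanSpace ℝ (Fin N)))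
    (hΩ : IsLipschitzDomain Ω) (hΩb : Bornology.IsBounded Ω)
    (s : ℝ) (hs0 : 0 < s) (hs1 : s < 1)
    (p : EuclideanSpace ℝ (Fin N) → EuclideanSpace ℝ (Fin N) → ℝ)
    (hp_cont : Continuous
      (fun z : EuclideanSpace ℝ (Fin N) × EuclideanSpace ℝ (Fin N) => p z.1 z.2))
    (hp_symm : ∀ x y, p x y = p y x)
    (pm pM : ℝ)
    (hpm : pm = sInf (Set.range
      fun z : EuclideanSpace ℝ (Fin N) × EuclideanSpace ℝ (Fin N) => p z.1 z.2))
    (hpM : pM = sSup (Set.range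
      fun z : EuclideanSpace ℝ (Fin N) × EuclideanSpace ℝ (Fin N) => p z.1 z.2))
    (hp_lb : 1 < pm)
    (hp_bddAbove : BddAbove (Set.range
      fun z : EuclideanSpace ℝ (Fin N) × EuclideanSpace ℝ (Fin N) => p z.1 z.2))
    (hp_ub : s * pM < N)
    (q : EuclideanSpace ℝ (Fin N) → ℝ) (hq_cont : ContinuousOn q (closure Ω))
    (hq_lb : 1 < sInf (q '' closure Ω)) (hq_bddAbove : BddAbove (q '' closure Ω))
    (hq_low : ∀ x ∈ closure Ω, p x x ≤ q x)
    (hq_sub : ∀ x ∈ closure Ω, q x < N * p x x / (N - s * p x x))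
    (qp : ℝ) (hqp : qp = sSup (q '' closure Ω))
    (f : EuclideanSpace ℝ (Fin N) → ℝ → ℝ)
    (hf_meas : ∀ t : ℝ, Measurable fun x => f x t)
    (hf_cont : ∀ᵐ x ∂(volume.restrict Ω), Continuous fun t => f x t)
    (hf_growth : ∃ C : ℝ, 0 < C ∧ ∀ᵐ x ∂(volume.restrict Ω), ∀ t : ℝ,
      |f x t| ≤ C * (1 + |t| ^ (q x - 1))) :
    ∃ C₁ : ℝ, 0 < C₁ ∧ ∀ u : EuclideanSpace ℝ (Fin N) → ℝ, IsWeakSolution Ω s p f u →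
      ∀ kstar : ℝ, 0 < kstar → ∀ n : ℕ,
        gagMod Set.univ s p
            (fun x => max (u x - kstar * (2 - 2 ^ (-((n : ℝ) + 1)))) 0)
          ≤ ENNReal.ofReal (C₁ * (1 + kstar ^ (-qp)) * 2 ^ ((n : ℝ) * qp)) *
            ∫⁻ x in {x ∈ Ω | kstar * (2 - 2 ^ (-(n : ℝ))) < u x},
              ENNReal.ofReal ((u x - kstar * (2 - 2 ^ (-(n : ℝ)))) ^ q x) := by
  have hp1 : ∀ x y, 1 < p x y := fun x y => by
    have hbdd : BddBelow (Set.range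
        fun z : EuclideanSpace ℝ (Fin N) × EuclideanSpace ℝ (Fin N) => p z.1 z.2) := by
      by_contra h
      rw [hpm, Real.sInf_of_not_bddBelow h] at hp_lb
      linarith
    rw [hpm] at hp_lb
    exact hp_lb.trans_le (csInf_le hbdd ⟨(x, y), rfl⟩)
  have hq1 : ∀ x ∈ Ω, 1 ≤ q x := fun x hx => by
    have hbdd : BddBelow (q '' closure Ω) := by
      by_contra h
      rw [Real.sInf_of_not_bddBelow h] at hq_lb
      linarith
    exact hq_lb.le.trans (csInf_le hbdd ⟨x, subset_closure hx, rfl⟩)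
  have hqQ : ∀ x ∈ Ω, q x ≤ qp := fun x hx => by
    rw [hqp]
    exact le_csSup hq_bddAbove ⟨x, subset_closure hx, rfl⟩
  obtain ⟨C, hC, hfC⟩ := hf_growth
  refine ⟨C * (2 * 2 ^ (2 * qp)), by positivity, fun u hu K hK n => ?_⟩
  obtain ⟨huW, hweak⟩ := hu
  set k : ℝ := K * (2 - 2 ^ (-((n : ℝ) + 1))) with hk
  set l : ℝ := K * (2 - 2 ^ (-(n : ℝ))) with hl
  have hk0 : 0 ≤ k := by
    have : (2 : ℝ) ^ (-((n : ℝ) + 1)) ≤ 1 :=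
      Real.rpow_le_one_of_one_le_of_nonpos (by norm_num) (by linarith [n.cast_nonneg (α := ℝ)])
    rw [hk]
    exact mul_nonneg hK.le (by linarith)
  have hlk : l ≤ k := by
    have : (2 : ℝ) ^ (-((n : ℝ) + 1)) ≤ 2 ^ (-(n : ℝ)) :=
      Real.rpow_le_rpow_of_exponent_le (by norm_num) (by linarith)
    rw [hk, hl]
    gcongr
  have hS : MeasurableSet {x | l < u x} := measurableSet_lt measurable_const huW.1
  refine (gagMod_posPart_le hp_cont.measurable hp1 huW.1 huW.2.2.1 k).trans ?_
  rw [hweak _ (memW0_posPart (fun x y => zero_le_one.trans (hp1 x y).le) huW hk0)]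
  refine (ofReal_integral_le_lintegral_ofReal _ _).trans ?_
  rw [← lintegral_const_mul' _ _ ENNReal.ofReal_ne_top, Set.ofPred_and, Set.ofPred_mem_eq,
    ← Set.inter_comm, ← Measure.restrict_restrict hS, ← lintegral_indicator hS]
  refine lintegral_mono_ae ?_
  filter_upwards [hfC, ae_restrict_mem hΩ.1.measurableSet] with x hfx hx
  rcases le_or_gt (u x) k with hux | hux
  · simp [max_eq_right (sub_nonpos.2 hux)]
  rw [Set.indicator_of_mem (show x ∈ {x | l < u x} from hlk.trans_lt hux),
    ← ENNReal.ofReal_mul (by positivity), max_eq_left (sub_nonneg.2 hux.le)]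
  refine ENNReal.ofReal_le_ofReal ?_
  have hgr := hfx (u x)
  rw [abs_of_pos (hk0.trans_lt hux)] at hgr
  calc f x (u x) * (u x - k) ≤ C * (1 + u x ^ (q x - 1)) * (u x - k) :=
        mul_le_mul_of_nonneg_right ((le_abs_self _).trans hgr) (sub_nonneg.2 hux.le)
    _ = C * ((1 + u x ^ (q x - 1)) * (u x - k)) := by ring
    _ ≤ C * (2 * 2 ^ (2 * qp) * (1 + K ^ (-qp)) * 2 ^ ((n : ℝ) * qp) * (u x - l) ^ q x) :=
        mul_le_mul_of_nonneg_left
          (one_add_rpow_mul_le_level hK (hq1 x hx) (hqQ x hx) n.cast_nonneg hux) hC.le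
    _ = _ := by ring
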